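/- Let P be a simple logic program without constraints and let M be a total founded interpretation of P such that the reduct P_M is maximal with respect to set inclusion among the reducts of founded interpretations of P. Then M is an extended answer set of P. -/

import Mathlib

namespace ASP

/-- A literal is an atom `a` or a negated atom `¬ a`. -/
inductive Lit (α : Type) : Type where
  | pos (a : α)
  | neg (a : α)
deriving DecidableEq

/-- Classical negation of a literal. -/
def Lit.negate {α : Type} : Lit α → Lit α
  | .pos a => .neg a
  | .neg a => .pos a

/-- The atom underlying a literal. -/
def Lit.atom {α : Type} : Lit α → α
  | .pos a => a
  | .neg a => a

/-- A rule of a simple logic program: a head which is a literal or absent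
(a constraint), and a finite set of literals as body. -/
structure Rule (α : Type) [DecidableEq α] : Type where
  head : Option (Lit α)
  body : Finset (Lit α)

variable {α : Type} [DecidableEq α]

/-- A set of literals is consistent if it contains no complementary pair. -/
def Consistent (I : Set (Lit α)) : Prop :=
  ∀ a : α, ¬(Lit.pos a ∈ I ∧ Lit.neg a ∈ I)

/-- The Herbrand base of a program: all atoms occurring in it. -/
def herbrand (P : Set (Rule α)) : Set α :=
  {a | ∃ r ∈ P, (∃ l, r.head = some l ∧ l.atom = a) ∨ (∃ l ∈ r.body, l.atom = a)}

/-- An interpretation of `P`: a consistent set of literals over the Herbrand base of `P`. -/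
def IsInterp (P : Set (Rule α)) (I : Set (Lit α)) : Prop :=
  Consistent I ∧ ∀ l ∈ I, l.atom ∈ herbrand P

/-- A rule `a ← β` is satisfied by `I` if `a ∈ I` whenever `β ⊆ I`;
a constraint `← β` is satisfied if its body is not contained in `I`. -/
def Satisfied (I : Set (Lit α)) (r : Rule α) : Prop :=
  ↑r.body ⊆ I → ∃ l, r.head = some l ∧ l ∈ I

/-- A rule is applied w.r.t. `I` if its body holds and its head literal is in `I`. -/
def Applied (I : Set (Lit α)) (r : Rule α) : Prop :=
  ↑r.body ⊆ I ∧ ∃ l, r.head = some l ∧ l ∈ I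

/-- A rule `a ← β` is defeated w.r.t. `P` and `I` iff `P` contains an applied
competing rule `¬a ← β'`. -/
def Defeated (P : Set (Rule α)) (I : Set (Lit α)) (r : Rule α) : Prop :=
  ∃ l, r.head = some l ∧ ∃ r' ∈ P, r'.head = some l.negate ∧ Applied I r'

/-- The reduct of `P` w.r.t. `I`: the rules of `P` satisfied by `I`. -/
def reduct (P : Set (Rule α)) (I : Set (Lit α)) : Set (Rule α) :=
  {r ∈ P | Satisfied I r}

/-- `star R` is the unique minimal model of `R` viewed as a positive program
(negative literals treated as fresh atoms; constraints never fire their head). -/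
def star (R : Set (Rule α)) : Set (Lit α) :=
  ⋂₀ {J : Set (Lit α) | ∀ r ∈ R, ↑r.body ⊆ J → ∀ l, r.head = some l → l ∈ J}

/-- An interpretation is founded iff `(P_I)* = I`. -/
def Founded (P : Set (Rule α)) (I : Set (Lit α)) : Prop :=
  star (reduct P I) = I

/-- A founded interpretation `M` is an extended answer set of `P` iff every rule
of `P` is satisfied or defeated w.r.t. `M`. -/
def ExtAnswerSet (P : Set (Rule α)) (M : Set (Lit α)) : Prop :=
  IsInterp P M ∧ Founded P M ∧ ∀ r ∈ P, Satisfied M r ∨ Defeated P M r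

/-- An answer set of a program without negation as failure: a minimal
interpretation satisfying all rules of the program. -/
def IsAnswerSet (P : Set (Rule α)) (M : Set (Lit α)) : Prop :=
  IsInterp P M ∧ (∀ r ∈ P, Satisfied M r) ∧
    ∀ J, IsInterp P J → (∀ r ∈ P, Satisfied J r) → ¬J ⊂ M

/-- Every literal of the minimal model of `R` is the head of a rule of `R` whose body holds in
that model. -/
theorem exists_rule_of_mem_star {R : Set (Rule α)} {l : Lit α} (hl : l ∈ star R) :
    ∃ r ∈ R, r.head = some l ∧ ↑r.body ⊆ star R := by
  by_contra! h
  have hmem : ∀ r ∈ R, ↑r.body ⊆ star R \ {l} → ∀ k, r.head = some k → k ∈ star R \ {l} := by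
    intro r hr hb k hk
    have hbody : ↑r.body ⊆ star R := hb.trans Set.sdiff_subset
    refine ⟨fun J hJ => hJ r hr (hbody.trans (Set.sInter_subset_of_mem hJ)) k hk, ?_⟩
    rintro rfl
    exact h r hr hk hbody
  exact (hl _ hmem).2 rfl

theorem Lit.mem_or_negate_mem {β : Type} {M : Set (Lit β)} {l : Lit β}
    (h : Lit.pos l.atom ∈ M ∨ Lit.neg l.atom ∈ M) : l ∈ M ∨ l.negate ∈ M := by
  cases l with
  | pos a => exact h
  | neg a => exact h.symm

/-- Let `P` be a simple logic program without constraints and let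
`M` be a total founded interpretation of `P` whose reduct `P_M` is maximal
w.r.t. set inclusion among reducts of founded interpretations of `P`.  Then `M`
is an extended answer set of `P`. -/
theorem total_max_reduct_is_extAnswerSet
    {α : Type} [DecidableEq α] (P : Set (Rule α)) (hP : P.Countable)
    (hNoConstraints : ∀ r ∈ P, r.head ≠ none)
    (M : Set (Lit α)) (hM : IsInterp P M)
    (hTotal : ∀ a ∈ herbrand P, Lit.pos a ∈ M ∨ Lit.neg a ∈ M)
    (hFounded : Founded P M)
    (hMax : ∀ N : Set (Lit α), IsInterp P N → Founded P N →
      ¬ reduct P M ⊂ reduct P N) :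
    ExtAnswerSet P M := by
  refine ⟨hM, hFounded, fun r hr => or_iff_not_imp_left.2 fun hns => ?_⟩
  obtain ⟨l, hl⟩ := Option.ne_none_iff_exists'.1 (hNoConstraints r hr)
  have hlM : l ∉ M := fun h => hns fun _ => ⟨l, hl, h⟩
  have hneg : l.negate ∈ M :=
    (Lit.mem_or_negate_mem (hTotal l.atom ⟨r, hr, Or.inl ⟨l, hl, rfl⟩⟩)).resolve_left hlM
  obtain ⟨r', hr', hhead, hbody⟩ :=
    exists_rule_of_mem_star (R := reduct P M) (l := l.negate) (hFounded.symm ▸ hneg)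
  rw [hFounded] at hbody
  exact ⟨l, hl, r', hr'.1, hhead, hbody, l.negate, hhead, hneg⟩

end ASP
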